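/- arXiv:1810.01131 — 4 statements merged into one kernel-verified Lean document; each statement's English description precedes it below -/
import Mathlib

section
/- For λ ∈ ℂ let T_λ be the ℂ-algebra automorphism of R determined by T_λ(a_k) = Σ_{j=0}^{k} a_j·λ^{k−j}/(k−j)! for all k ∈ ℕ. Then a polynomial f ∈ R satisfies T_λ(f) = f for all λ ∈ ℂ if and only if D f = 0. -/
open MvPolynomial

/-- The exponential `exp (t D)` of the down-shift derivation, as an algebra homomorphism into
polynomials in `t` over `ℂ[a₀, a₁, …]`. -/
noncomputable def expShift : MvPolynomial ℕ ℂ →ₐ[ℂ] Polynomial (MvPolynomial ℕ ℂ) :=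
  aeval fun k => ∑ j ∈ Finset.range (k + 1),
    Polynomial.monomial (k - j) (C (1 / (Nat.factorial (k - j) : ℂ)) * X j)

theorem expShift_X (k : ℕ) : expShift (X k) = ∑ j ∈ Finset.range (k + 1),
    Polynomial.monomial (k - j) (C (1 / (Nat.factorial (k - j) : ℂ)) * X j) := by
  simp only [expShift, aeval_X]

theorem derivative_expShift_X_zero :
    Polynomial.derivative (expShift (X 0)) = 0 := by
  simp [expShift_X]

theorem derivative_expShift_X_succ (k : ℕ) :
    Polynomial.derivative (expShift (X (k + 1))) = expShift (X k) := by
  rw [expShift_X, expShift_X, Finset.sum_range_succ, Polynomial.derivative_add,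
    Polynomial.derivative_sum, Nat.sub_self, Polynomial.monomial_zero_left,
    Polynomial.derivative_C, add_zero]
  refine Finset.sum_congr rfl fun j hj => ?_
  have hjk : k + 1 - j = (k - j) + 1 := by
    have := Finset.mem_range.mp hj
    omega
  rw [Polynomial.derivative_monomial, hjk, Nat.add_sub_cancel]
  congr 1
  have hcast : (((k - j) + 1 : ℕ) : MvPolynomial ℕ ℂ) = C (((k - j) + 1 : ℕ) : ℂ) :=
    (map_natCast C _).symm
  rw [hcast, mul_right_comm, ← C_mul]
  congr 2
  have h₁ : (((k - j) + 1 : ℕ) : ℂ) ≠ 0 := Nat.cast_ne_zero.mpr (Nat.succ_ne_zero _)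
  have h₂ : (Nat.factorial (k - j) : ℂ) ≠ 0 := Nat.cast_ne_zero.mpr (Nat.factorial_ne_zero _)
  rw [Nat.factorial_succ, Nat.cast_mul]
  field_simp

theorem derivative_expShift
    (D : Derivation ℂ (MvPolynomial ℕ ℂ) (MvPolynomial ℕ ℂ))
    (hD0 : D (X 0) = 0) (hD : ∀ i : ℕ, D (X (i + 1)) = X i) (f : MvPolynomial ℕ ℂ) :
    Polynomial.derivative (expShift f) = expShift (D f) := by
  induction f using MvPolynomial.induction_on with
  | C a =>
    rw [← algebraMap_eq, D.map_algebraMap, map_zero, AlgHom.commutes,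
      Polynomial.algebraMap_apply, Polynomial.derivative_C]
  | add p q hp hq => simp only [map_add, hp, hq]
  | mul_X p n hp =>
    have hX : Polynomial.derivative (expShift (X n)) = expShift (D (X n)) := by
      cases n with
      | zero => rw [derivative_expShift_X_zero, hD0, map_zero]
      | succ k => rw [derivative_expShift_X_succ, hD]
    rw [map_mul, Polynomial.derivative_mul, hp, hX, D.leibniz]
    simp only [smul_eq_mul, map_add, map_mul]
    ring

theorem eval_expShift (lam : ℂ) (φ : MvPolynomial ℕ ℂ →ₐ[ℂ] MvPolynomial ℕ ℂ)
    (hφ : ∀ k : ℕ, φ (X k) = ∑ j ∈ Finset.range (k + 1),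
      C (lam ^ (k - j) / (Nat.factorial (k - j) : ℂ)) * X j)
    (f : MvPolynomial ℕ ℂ) :
    (expShift f).eval (C lam) = φ f := by
  induction f using MvPolynomial.induction_on with
  | C a =>
    rw [← algebraMap_eq, AlgHom.commutes, AlgHom.commutes, Polynomial.algebraMap_apply,
      Polynomial.eval_C]
  | add p q hp hq => rw [map_add, map_add, Polynomial.eval_add, hp, hq]
  | mul_X p n hp =>
    rw [map_mul, map_mul, Polynomial.eval_mul, hp, hφ, expShift_X, Polynomial.eval_finsetSum]
    congr 1
    refine Finset.sum_congr rfl fun j _ => ?_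
    rw [Polynomial.eval_monomial, ← C_pow, mul_right_comm, ← C_mul, one_div_mul_eq_div]

theorem eval_zero_expShift (f : MvPolynomial ℕ ℂ) : (expShift f).eval 0 = f := by
  rw [← C_0, eval_expShift 0 (AlgHom.id ℂ _)]
  · rfl
  · intro k
    rw [Finset.sum_range_succ, Finset.sum_eq_zero]
    · simp
    · intro j hj
      have : k - j ≠ 0 := Nat.sub_ne_zero_of_lt (Finset.mem_range.mp hj)
      simp [this]

/-- Let `R = ℂ[a₀,a₁,…]` (here `MvPolynomial ℕ ℂ`, with `aᵢ = X i`),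
`D` the unique ℂ-linear derivation with `D a₀ = 0`, `D aᵢ = a_{i-1}` for `i ≥ 1`,
and for `λ ∈ ℂ` let `T_λ` be the ℂ-algebra automorphism with
`T_λ (a_k) = ∑_{j=0}^{k} a_j λ^{k-j}/(k-j)!`.  Then `T_λ f = f` for all `λ` iff `D f = 0`. -/
theorem stmt0
    (D : Derivation ℂ (MvPolynomial ℕ ℂ) (MvPolynomial ℕ ℂ))
    (hD0 : D (X 0) = 0) (hD : ∀ i : ℕ, D (X (i + 1)) = X i)
    (T : ℂ → (MvPolynomial ℕ ℂ ≃ₐ[ℂ] MvPolynomial ℕ ℂ))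
    (hT : ∀ (lam : ℂ) (k : ℕ), T lam (X k) =
      ∑ j ∈ Finset.range (k + 1),
        C (lam ^ (k - j) / (Nat.factorial (k - j) : ℂ)) * X j)
    (f : MvPolynomial ℕ ℂ) :
    (∀ lam : ℂ, T lam f = f) ↔ D f = 0 := by
  have hT' (lam : ℂ) : (expShift f).eval (C lam) = T lam f :=
    eval_expShift lam (T lam : MvPolynomial ℕ ℂ →ₐ[ℂ] MvPolynomial ℕ ℂ) (hT lam) f
  constructor
  · intro h
    have hconst : expShift f = Polynomial.C f := by
      refine Polynomial.eq_of_infinite_eval_eq _ _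
        ((Set.infinite_range_of_injective (C_injective ℕ ℂ)).mono ?_)
      rintro _ ⟨lam, rfl⟩
      rw [Set.mem_ofPred_eq, hT', h, Polynomial.eval_C]
    rw [← eval_zero_expShift (D f), ← derivative_expShift D hD0 hD, hconst,
      Polynomial.derivative_C, Polynomial.eval_zero]
  · intro h lam
    have hder : Polynomial.derivative (expShift f) = 0 := by
      rw [derivative_expShift D hD0 hD, h, map_zero]
    have hconst := Polynomial.eq_C_of_derivative_eq_zero hder
    rw [← hT', hconst, Polynomial.eval_C, Polynomial.coeff_zero_eq_eval_zero,
      eval_zero_expShift]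
end

section
/- For every n ∈ ℕ and every g ≥ 1, applying D coefficientwise to the potenziante (i.e. applying id ⊗ D in ℂ[λ₁,…,λₙ] ⊗_ℂ R) gives (id ⊗ D)(π_{n,g}) = (λ₁+⋯+λₙ) · π_{n,g−1}. -/
open MvPolynomial TensorProduct

noncomputable section

/-- The potenziante `π_{n,g} = ∑_{r₁+⋯+rₙ=g} λ₁^{r₁}⋯λₙ^{rₙ} ⊗ a_{r₁}⋯a_{rₙ}`
as an element of `ℂ[λ₁,…,λₙ] ⊗_ℂ R`, where `R = ℂ[a₀,a₁,…] = MvPolynomial ℕ ℂ`. -/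
def pot (n g : ℕ) : MvPolynomial (Fin n) ℂ ⊗[ℂ] MvPolynomial ℕ ℂ :=
  ∑ r ∈ Finset.Nat.antidiagonalTuple n g,
    (∏ i : Fin n, X i ^ r i) ⊗ₜ[ℂ] (∏ i : Fin n, X (r i))

/-- The Leibniz rule for a finite product. -/
theorem derivation_prod {R A ι : Type*} [CommSemiring R] [CommSemiring A] [Algebra R A]
    [DecidableEq ι] (D : Derivation R A A) (s : Finset ι) (f : ι → A) :
    D (∏ i ∈ s, f i) = ∑ i ∈ s, (∏ j ∈ s.erase i, f j) * D (f i) := by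
  induction s using Finset.induction_on with
  | empty => simp
  | insert a s ha ih =>
    rw [Finset.prod_insert ha, D.leibniz, ih, Finset.sum_insert ha, Finset.erase_insert ha,
      smul_eq_mul, smul_eq_mul, Finset.mul_sum, add_comm]
    congr 1
    refine Finset.sum_congr rfl fun i hi => ?_
    have hia : a ≠ i := fun h => ha (h ▸ hi)
    rw [Finset.erase_insert_of_ne hia, Finset.prod_insert (by simp [ha]), mul_assoc]

/-- Reindexing `r = s + eᵢ` identifies the terms in which `D` hits the `i`-th factor with the
terms of `π_{n,g}` multiplied by `λᵢ`. -/
theorem sum_antidiagonalTuple_succ_derivation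
    (D : Derivation ℂ (MvPolynomial ℕ ℂ) (MvPolynomial ℕ ℂ))
    (hD0 : D (X 0) = 0) (hD : ∀ i : ℕ, D (X (i + 1)) = X i) (n g : ℕ) (i : Fin n) :
    ∑ r ∈ Finset.Nat.antidiagonalTuple n (g + 1),
        (∏ j : Fin n, (X j : MvPolynomial (Fin n) ℂ) ^ r j) ⊗ₜ[ℂ]
          ((∏ j ∈ Finset.univ.erase i, X (r j)) * D (X (r i))) =
      ((X i : MvPolynomial (Fin n) ℂ) ⊗ₜ[ℂ] (1 : MvPolynomial ℕ ℂ)) * pot n g := by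
  rw [pot, Finset.mul_sum]
  symm
  refine Finset.sum_of_injOn (fun s => s + Pi.single i 1)
    (fun _ _ _ _ h => add_right_cancel h) ?_ ?_ ?_
  · intro s hs
    simp only [Finset.mem_coe, Finset.Nat.mem_antidiagonalTuple] at hs ⊢
    simp [Finset.sum_add_distrib, hs]
  · intro r hr hri
    rcases hk : r i with _ | k
    · simp [hD0]
    · have hle : Pi.single i 1 ≤ r := by
        intro j
        rcases eq_or_ne j i with rfl | hj
        · simp [hk]
        · simp [hj]
      refine absurd ⟨r - Pi.single i 1, ?_, tsub_add_cancel_of_le hle⟩ hri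
      rw [Finset.Nat.mem_antidiagonalTuple] at hr
      have h : ∑ j, ((r - Pi.single i 1) + Pi.single i 1 : Fin n → ℕ) j = g + 1 := by
        rw [tsub_add_cancel_of_le hle, hr]
      simpa [Finset.sum_add_distrib, Finset.Nat.mem_antidiagonalTuple] using h
  · intro s _
    rw [Algebra.TensorProduct.tmul_mul_tmul, one_mul]
    congr 1
    · simp only [Pi.add_apply, pow_add, Finset.prod_mul_distrib]
      simp [mul_comm, Pi.single_apply, pow_ite]
    · rw [← Finset.prod_erase_mul _ _ (Finset.mem_univ i)]
      congr 1
      · refine Finset.prod_congr rfl fun j hj => ?_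
        simp [Finset.ne_of_mem_erase hj]
      · simp [hD]

/-- applying `D` coefficientwise to the potenziante (i.e. applying
`id ⊗ D` in `ℂ[λ₁,…,λₙ] ⊗_ℂ R`) gives
`(id ⊗ D)(π_{n,g}) = (λ₁+⋯+λₙ) ⬝ π_{n,g-1}` for every `g ≥ 1`. -/
theorem stmt5
    (D : Derivation ℂ (MvPolynomial ℕ ℂ) (MvPolynomial ℕ ℂ))
    (hD0 : D (X 0) = 0) (hD : ∀ i : ℕ, D (X (i + 1)) = X i)
    (n g : ℕ) (hg : 1 ≤ g) :
    LinearMap.lTensor (MvPolynomial (Fin n) ℂ) (D : MvPolynomial ℕ ℂ →ₗ[ℂ] MvPolynomial ℕ ℂ)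
        (pot n g) =
      ((∑ i : Fin n, X i) ⊗ₜ[ℂ] (1 : MvPolynomial ℕ ℂ)) * pot n (g - 1) := by
  obtain ⟨g, rfl⟩ := Nat.exists_eq_add_of_le' hg
  rw [Nat.add_sub_cancel, sum_tmul, Finset.sum_mul]
  simp_rw [← sum_antidiagonalTuple_succ_derivation D hD0 hD]
  rw [Finset.sum_comm, pot, map_sum]
  refine Finset.sum_congr rfl fun r _ => ?_
  rw [LinearMap.lTensor_tmul, Derivation.coeFn_coe, derivation_prod, tmul_sum]
end
end

section
/- For every n ≥ 1 and g ∈ ℕ, the dimension of S_{n,g} over ℂ equals the number of tuples (k₂,…,kₙ) ∈ ℕ^{n−1} with 2k₂+3k₃+⋯+nkₙ = g, i.e. the number of partitions of g with all parts of size between 2 and n (equivalently, the coefficient of x^g in 1/((1−x²)(1−x³)⋯(1−xⁿ))). -/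
open MvPolynomial

noncomputable section

/-- `R_{n,g}`: the ℂ-span of the monomials of degree `n` and weight `g` in
`R = ℂ[a₀,a₁,…] = MvPolynomial ℕ ℂ` (with `aᵢ = X i`). -/
def Rng (n g : ℕ) : Submodule ℂ (MvPolynomial ℕ ℂ) :=
  Submodule.span ℂ {p : MvPolynomial ℕ ℂ | ∃ m : ℕ →₀ ℕ,
    (m.sum fun _ e => e) = n ∧ (m.sum fun i e => i * e) = g ∧ p = monomial m 1}

/-- The exponents of the monomials of degree `n` and weight `g`. -/
def exponents (n g : ℕ) : Set (ℕ →₀ ℕ) :=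
  {m | (m.sum fun _ e => e) = n ∧ (m.sum fun i e => i * e) = g}

theorem sum_degree_add (m m' : ℕ →₀ ℕ) :
    ((m + m').sum fun _ e => e) = (m.sum fun _ e => e) + m'.sum fun _ e => e :=
  Finsupp.sum_add_index' (fun _ => rfl) (fun _ _ _ => rfl)

theorem sum_weight_add (m m' : ℕ →₀ ℕ) :
    ((m + m').sum fun i e => i * e) = (m.sum fun i e => i * e) + m'.sum fun i e => i * e :=
  Finsupp.sum_add_index' (fun _ => mul_zero _) (fun _ _ _ => mul_add _ _ _)

theorem add_single_mem_exponents {n w : ℕ} {m : ℕ →₀ ℕ} (hm : m ∈ exponents n w) (k : ℕ) :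
    m + Finsupp.single k 1 ∈ exponents (n + 1) (w + k) := by
  obtain ⟨h1, h2⟩ := hm
  refine ⟨?_, ?_⟩
  · rw [sum_degree_add, h1, Finsupp.sum_single_index rfl]
  · rw [sum_weight_add, h2, Finsupp.sum_single_index (mul_zero _), mul_one]

theorem exists_add_single_of_ne_zero {n g k : ℕ} {m : ℕ →₀ ℕ} (hm : m ∈ exponents (n + 1) g)
    (hk : m k ≠ 0) :
    ∃ w m', m' ∈ exponents n w ∧ w + k = g ∧ m = m' + Finsupp.single k 1 := by
  have hle : Finsupp.single k 1 ≤ m := by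
    rw [Finsupp.single_le_iff]; omega
  obtain ⟨m', rfl⟩ := exists_add_of_le hle
  obtain ⟨h1, h2⟩ := hm
  rw [sum_degree_add, Finsupp.sum_single_index rfl] at h1
  rw [sum_weight_add, Finsupp.sum_single_index (mul_zero _), mul_one] at h2
  exact ⟨_, m', ⟨by omega, rfl⟩, by omega, add_comm _ _⟩

theorem exponents_zero_left (g : ℕ) : exponents 0 g = if g = 0 then {0} else ∅ := by
  have key : ∀ m : ℕ →₀ ℕ, (m.sum fun _ e => e) = 0 ↔ m = 0 := fun m =>
    Finsupp.degree_eq_zero_iff m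
  ext m
  simp only [exponents, Set.mem_ofPred_eq, key]
  constructor
  · rintro ⟨rfl, h⟩
    simp at h
    simp [← h]
  · split_ifs with h
    · rintro rfl
      simp [h]
    · rintro ⟨⟩

/-- Multiplication by the variable `a₀`, on exponents. -/
def addZero (m : ℕ →₀ ℕ) : ℕ →₀ ℕ := m + Finsupp.single 0 1

/-- The shift `aᵢ ↦ aᵢ₊₁`, on exponents. -/
def shift (m : ℕ →₀ ℕ) : ℕ →₀ ℕ := m.embDomain (addRightEmbedding 1)

theorem addZero_injective : Function.Injective addZero := fun _ _ h => add_right_cancel h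

theorem shift_injective : Function.Injective shift := Finsupp.embDomain_injective _

theorem shift_apply_zero (m : ℕ →₀ ℕ) : shift m 0 = 0 :=
  Finsupp.embDomain_of_notMem_range _ _ _ (by simp)

theorem shift_mem_exponents_iff {n g : ℕ} {m : ℕ →₀ ℕ} :
    shift m ∈ exponents n (g + n) ↔ m ∈ exponents n g := by
  have h1 : ((shift m).sum fun _ e => e) = m.sum fun _ e => e := by
    simp [shift, Finsupp.sum_embDomain]
  have h2 : ((shift m).sum fun i e => i * e) =
      (m.sum fun i e => i * e) + m.sum fun _ e => e := by
    simp only [shift, Finsupp.sum_embDomain, addRightEmbedding_apply, add_mul, one_mul]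
    exact Finsupp.sum_add
  simp only [exponents, Set.mem_ofPred_eq, h1, h2]
  omega

theorem exists_shift_eq {m : ℕ →₀ ℕ} (h : m 0 = 0) : ∃ m', shift m' = m := by
  refine ⟨m.comapDomain (· + 1) (add_left_injective 1).injOn, ?_⟩
  ext i
  cases i with
  | zero => rw [shift_apply_zero, h]
  | succ i => exact Finsupp.embDomain_apply_self (addRightEmbedding 1) _ i

theorem degree_le_weight {n g : ℕ} {m : ℕ →₀ ℕ} (hm : m ∈ exponents n g) (h : m 0 = 0) :
    n ≤ g := by
  obtain ⟨rfl, rfl⟩ := hm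
  refine Finset.sum_le_sum fun i hi => Nat.le_mul_of_pos_left _ (Nat.pos_of_ne_zero ?_)
  rintro rfl
  exact Finsupp.mem_support_iff.mp hi h

theorem exponents_succ_of_lt {n g : ℕ} (hg : g < n + 1) :
    exponents (n + 1) g = addZero '' exponents n g := by
  ext m
  constructor
  · intro hm
    have h0 : m 0 ≠ 0 := fun h => by have := degree_le_weight hm h; omega
    obtain ⟨w, m', hm', hw, rfl⟩ := exists_add_single_of_ne_zero hm h0
    obtain rfl : w = g := hw
    exact ⟨m', hm', rfl⟩
  · rintro ⟨m', hm', rfl⟩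
    exact add_single_mem_exponents hm' 0

theorem exponents_succ_add (n g : ℕ) :
    exponents (n + 1) (g + (n + 1)) =
      addZero '' exponents n (g + (n + 1)) ∪ shift '' exponents (n + 1) g := by
  ext m
  constructor
  · intro hm
    by_cases h0 : m 0 = 0
    · obtain ⟨m', rfl⟩ := exists_shift_eq h0
      exact Or.inr ⟨m', shift_mem_exponents_iff.mp hm, rfl⟩
    · obtain ⟨w, m', hm', hw, rfl⟩ := exists_add_single_of_ne_zero hm h0
      obtain rfl : w = g + (n + 1) := hw
      exact Or.inl ⟨m', hm', rfl⟩
  · rintro (⟨m', hm', rfl⟩ | ⟨m', hm', rfl⟩)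
    · exact add_single_mem_exponents hm' 0
    · exact shift_mem_exponents_iff.mpr hm'

theorem finite_exponents (n g : ℕ) : (exponents n g).Finite := by
  induction n generalizing g with
  | zero => rw [exponents_zero_left]; split_ifs <;> simp
  | succ n ihn =>
    induction g using Nat.strong_induction_on with
    | _ g ihg =>
      rcases lt_or_ge g (n + 1) with h | h
      · rw [exponents_succ_of_lt h]
        exact (ihn g).image _
      · obtain ⟨g, rfl⟩ := Nat.exists_eq_add_of_le' h
        rw [exponents_succ_add]
        exact ((ihn _).image _).union ((ihg g (by omega)).image _)

theorem ncard_exponents_zero_left (g : ℕ) : (exponents 0 g).ncard = if g = 0 then 1 else 0 := by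
  rw [exponents_zero_left]
  split_ifs <;> simp

theorem ncard_exponents_succ_of_lt {n g : ℕ} (hg : g < n + 1) :
    (exponents (n + 1) g).ncard = (exponents n g).ncard := by
  rw [exponents_succ_of_lt hg, Set.ncard_image_of_injective _ addZero_injective]

theorem ncard_exponents_succ_add (n g : ℕ) :
    (exponents (n + 1) (g + (n + 1))).ncard =
      (exponents n (g + (n + 1))).ncard + (exponents (n + 1) g).ncard := by
  rw [exponents_succ_add, Set.ncard_union_eq _ ((finite_exponents _ _).image _)
    ((finite_exponents _ _).image _), Set.ncard_image_of_injective _ addZero_injective,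
    Set.ncard_image_of_injective _ shift_injective]
  rw [Set.disjoint_left]
  rintro _ ⟨m, -, rfl⟩ ⟨m', -, h⟩
  have := DFunLike.congr_fun h 0
  simp [shift_apply_zero, addZero] at this

theorem ncard_exponents_zero_right (n : ℕ) : (exponents n 0).ncard = 1 := by
  induction n with
  | zero => simp [ncard_exponents_zero_left]
  | succ n ih => rw [ncard_exponents_succ_of_lt n.succ_pos, ih]

theorem ncard_exponents_one (g : ℕ) : (exponents 1 g).ncard = 1 := by
  induction g with
  | zero => exact ncard_exponents_zero_right 1
  | succ g ih => rw [ncard_exponents_succ_add 0 g, ih, ncard_exponents_zero_left]; simp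

/-- The partitions of `g` with all parts between `2` and `m + 1`, encoded by the multiplicities
of the parts. -/
def multiplicities (m g : ℕ) : Set (Fin m → ℕ) :=
  {k | ∑ i : Fin m, ((i : ℕ) + 2) * k i = g}

theorem coe_filter_piFinset (m g : ℕ) :
    (((Fintype.piFinset fun _ : Fin m => Finset.range (g + 1)).filter
      (fun k => ∑ i : Fin m, ((i : ℕ) + 2) * k i = g) : Finset (Fin m → ℕ)) :
        Set (Fin m → ℕ)) = multiplicities m g := by
  ext k
  simp only [Finset.coe_filter, Fintype.mem_piFinset, Finset.mem_range, Set.mem_ofPred_eq,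
    multiplicities, and_iff_right_iff_imp]
  rintro rfl i
  have : ((i : ℕ) + 2) * k i ≤ ∑ j : Fin m, ((j : ℕ) + 2) * k j :=
    Finset.single_le_sum (f := fun j : Fin m => ((j : ℕ) + 2) * k j)
      (fun _ _ => Nat.zero_le _) (Finset.mem_univ i)
  nlinarith

theorem finite_multiplicities (m g : ℕ) : (multiplicities m g).Finite := by
  rw [← coe_filter_piFinset]
  exact Finset.finite_toSet _

theorem snoc_mem_multiplicities_iff {m g : ℕ} {k : Fin m → ℕ} {a : ℕ} :
    (Fin.snoc k a : Fin (m + 1) → ℕ) ∈ multiplicities (m + 1) g ↔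
      (∑ i : Fin m, ((i : ℕ) + 2) * k i) + (m + 2) * a = g := by
  simp [multiplicities, Fin.sum_univ_castSucc]

/-- Appending a zero multiplicity. -/
def snocZero {m : ℕ} (k : Fin m → ℕ) : Fin (m + 1) → ℕ := Fin.snoc k 0

/-- Increasing the last multiplicity by one. -/
def succLast {m : ℕ} (k : Fin (m + 1) → ℕ) : Fin (m + 1) → ℕ :=
  Fin.snoc (Fin.init k) (k (Fin.last m) + 1)

theorem snocZero_injective {m : ℕ} : Function.Injective (snocZero (m := m)) :=
  fun _ _ h => (Fin.snoc_inj.mp h).1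

theorem succLast_injective {m : ℕ} : Function.Injective (succLast (m := m)) := by
  intro k k' h
  obtain ⟨h1, h2⟩ := Fin.snoc_inj.mp h
  rw [← Fin.snoc_init_self k, ← Fin.snoc_init_self k', h1, Nat.succ_injective h2]

theorem multiplicities_succ_of_lt {m g : ℕ} (hg : g < m + 2) :
    multiplicities (m + 1) g = snocZero '' multiplicities m g := by
  ext k
  induction k using Fin.snocCases with
  | snoc k a =>
    rw [snoc_mem_multiplicities_iff]
    constructor
    · intro h
      obtain rfl : a = 0 := by
        by_contra ha
        have := Nat.le_mul_of_pos_right (m + 2) (Nat.pos_of_ne_zero ha)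
        omega
      exact ⟨k, h, rfl⟩
    · rintro ⟨k', hk', h⟩
      obtain ⟨rfl, rfl⟩ := Fin.snoc_inj.mp h
      exact hk'

theorem multiplicities_succ_add (m g : ℕ) :
    multiplicities (m + 1) (g + (m + 2)) =
      snocZero '' multiplicities m (g + (m + 2)) ∪ succLast '' multiplicities (m + 1) g := by
  ext k
  induction k using Fin.snocCases with
  | snoc k a =>
    rw [snoc_mem_multiplicities_iff]
    constructor
    · intro h
      cases a with
      | zero => exact Or.inl ⟨k, h, rfl⟩
      | succ a =>
        refine Or.inr ⟨Fin.snoc k a, snoc_mem_multiplicities_iff.mpr ?_, ?_⟩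
        · rw [mul_add] at h; omega
        · simp [succLast]
    · rintro (⟨k', hk', h⟩ | ⟨k', hk', h⟩)
      · obtain ⟨rfl, rfl⟩ := Fin.snoc_inj.mp h
        exact hk'
      · rw [← Fin.snoc_init_self k', snoc_mem_multiplicities_iff] at hk'
        obtain ⟨rfl, rfl⟩ := Fin.snoc_inj.mp h
        rw [mul_add]; omega

theorem ncard_multiplicities_succ_of_lt {m g : ℕ} (hg : g < m + 2) :
    (multiplicities (m + 1) g).ncard = (multiplicities m g).ncard := by
  rw [multiplicities_succ_of_lt hg, Set.ncard_image_of_injective _ snocZero_injective]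

theorem ncard_multiplicities_succ_add (m g : ℕ) :
    (multiplicities (m + 1) (g + (m + 2))).ncard =
      (multiplicities m (g + (m + 2))).ncard + (multiplicities (m + 1) g).ncard := by
  rw [multiplicities_succ_add, Set.ncard_union_eq _ ((finite_multiplicities _ _).image _)
    ((finite_multiplicities _ _).image _), Set.ncard_image_of_injective _ snocZero_injective,
    Set.ncard_image_of_injective _ succLast_injective]
  rw [Set.disjoint_left]
  rintro _ ⟨k, -, rfl⟩ ⟨k', -, h⟩
  exact Nat.succ_ne_zero _ (Fin.snoc_inj.mp h).2

theorem ncard_multiplicities_zero_left (g : ℕ) :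
    (multiplicities 0 g).ncard = if g = 0 then 1 else 0 := by
  rcases eq_or_ne g 0 with rfl | h
  · simp [multiplicities]
  · simp [multiplicities, h, h.symm]

theorem ncard_multiplicities_zero_right (m : ℕ) : (multiplicities m 0).ncard = 1 := by
  induction m with
  | zero => simp [ncard_multiplicities_zero_left]
  | succ m ih => rw [ncard_multiplicities_succ_of_lt (by omega), ih]

theorem ncard_exponents_add_one (m g : ℕ) :
    (exponents (m + 1) (g + 1)).ncard =
      (exponents (m + 1) g).ncard + (multiplicities m (g + 1)).ncard := by
  induction m generalizing g with
  | zero => simp [ncard_exponents_one, ncard_multiplicities_zero_left]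
  | succ m ihm =>
    induction g using Nat.strong_induction_on with
    | _ g ihg =>
      rcases lt_trichotomy (g + 1) (m + 2) with h | h | h
      · rw [ncard_exponents_succ_of_lt (n := m + 1) h,
          ncard_exponents_succ_of_lt (show g < m + 1 + 1 by omega),
          ncard_multiplicities_succ_of_lt h, ihm]
      · have h1 := ncard_exponents_succ_add (m + 1) 0
        have h2 := ncard_multiplicities_succ_add m 0
        rw [ncard_exponents_zero_right, zero_add, show m + 1 + 1 = g + 1 by omega] at h1
        rw [ncard_multiplicities_zero_right, zero_add, ← h] at h2
        rw [show m + 1 + 1 = g + 1 by omega, h1, h2, ihm,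
          ← ncard_exponents_succ_of_lt (show g < m + 1 + 1 by omega),
          show m + 1 + 1 = g + 1 by omega]
        omega
      · obtain ⟨j, rfl⟩ := Nat.exists_eq_add_of_le' (show m + 2 ≤ g by omega)
        have h1 := ncard_exponents_succ_add (m + 1) (j + 1)
        have h2 := ncard_multiplicities_succ_add m (j + 1)
        have h3 := ncard_exponents_succ_add (m + 1) j
        have h4 := ihg j (by omega)
        have h5 := ihm (j + (m + 2))
        rw [show j + 1 + (m + 1 + 1) = j + (m + 2) + 1 by omega] at h1
        rw [show j + 1 + (m + 2) = j + (m + 2) + 1 by omega] at h2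
        rw [h1, h2, show j + (m + 2) = j + (m + 1 + 1) by omega, h3]
        rw [show j + (m + 2) = j + (m + 1 + 1) by omega] at h5
        omega

theorem Rng_eq_span_range (n g : ℕ) :
    Rng n g =
      Submodule.span ℂ (Set.range fun m : exponents n g => monomial (m : ℕ →₀ ℕ) (1 : ℂ)) := by
  refine congrArg _ (Set.ext fun p => ⟨?_, ?_⟩)
  · rintro ⟨m, h1, h2, rfl⟩
    exact ⟨⟨m, h1, h2⟩, rfl⟩
  · rintro ⟨⟨m, h1, h2⟩, rfl⟩
    exact ⟨m, h1, h2, rfl⟩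

theorem monomial_mem_Rng {n g : ℕ} {m : ℕ →₀ ℕ} (hm : m ∈ exponents n g) :
    monomial m (1 : ℂ) ∈ Rng n g :=
  Submodule.subset_span ⟨m, hm.1, hm.2, rfl⟩

theorem finrank_Rng (n g : ℕ) : Module.finrank ℂ (Rng n g) = (exponents n g).ncard := by
  have := (finite_exponents n g).fintype
  have hli : LinearIndependent ℂ (fun m : exponents n g => monomial (m : ℕ →₀ ℕ) (1 : ℂ)) := by
    have h := (basisMonomials ℕ ℂ).linearIndependent
    rw [coe_basisMonomials] at h
    exact h.comp _ Subtype.val_injective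
  rw [Rng_eq_span_range, finrank_span_eq_card hli, ← Nat.card_eq_fintype_card,
    Nat.card_coe_set_eq]

instance finiteDimensional_Rng (n g : ℕ) : FiniteDimensional ℂ (Rng n g) := by
  have := (finite_exponents n g).to_subtype
  rw [Rng_eq_span_range]
  exact FiniteDimensional.span_of_finite ℂ (Set.finite_range _)

theorem mul_X_mem_Rng {n w : ℕ} {p : MvPolynomial ℕ ℂ} (hp : p ∈ Rng n w) (k : ℕ) :
    p * X k ∈ Rng (n + 1) (w + k) := by
  induction hp using Submodule.span_induction with
  | mem p hp =>
    obtain ⟨m, h1, h2, rfl⟩ := hp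
    rw [X, monomial_mul, one_mul]
    exact monomial_mem_Rng (add_single_mem_exponents ⟨h1, h2⟩ k)
  | zero => rw [zero_mul]; exact zero_mem _
  | add p q _ _ hp hq => rw [add_mul]; exact add_mem hp hq
  | smul c p _ hp => rw [smul_mul_assoc]; exact Submodule.smul_mem _ c hp

theorem Rng_zero_left_le (g : ℕ) : Rng 0 g ≤ Submodule.span ℂ {1} := by
  refine Submodule.span_mono ?_
  rintro p ⟨m, h1, -, rfl⟩
  obtain rfl : m = 0 := (Finsupp.degree_eq_zero_iff m).mp h1
  rfl

theorem Rng_succ_le {n g : ℕ} {M : Submodule ℂ (MvPolynomial ℕ ℂ)}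
    (h : ∀ w k p, w + k = g → p ∈ Rng n w → p * X k ∈ M) : Rng (n + 1) g ≤ M := by
  refine Submodule.span_le.mpr ?_
  rintro p ⟨m, h1, h2, rfl⟩
  obtain ⟨k, hk⟩ : ∃ k, m k ≠ 0 := by
    by_contra! hm
    obtain rfl : m = 0 := Finsupp.ext hm
    simp at h1
  obtain ⟨w, m', hm', hw, rfl⟩ := exists_add_single_of_ne_zero ⟨h1, h2⟩ hk
  have := h w k _ hw (monomial_mem_Rng hm')
  rwa [X, monomial_mul, one_mul] at this

section Derivation

variable {D : Derivation ℂ (MvPolynomial ℕ ℂ) (MvPolynomial ℕ ℂ)}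

theorem Rng_zero_left_le_ker (g : ℕ) :
    Rng 0 g ≤ LinearMap.ker (D : MvPolynomial ℕ ℂ →ₗ[ℂ] MvPolynomial ℕ ℂ) :=
  (Rng_zero_left_le g).trans (Submodule.span_le.mpr (by simp))

theorem Rng_zero_right_le_ker (hD0 : D (X 0) = 0) (n : ℕ) :
    Rng n 0 ≤ LinearMap.ker (D : MvPolynomial ℕ ℂ →ₗ[ℂ] MvPolynomial ℕ ℂ) := by
  induction n with
  | zero => exact Rng_zero_left_le_ker 0
  | succ n ih =>
    refine Rng_succ_le fun w k p hwk hp => ?_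
    obtain ⟨rfl, rfl⟩ : w = 0 ∧ k = 0 := by omega
    have : D p = 0 := ih hp
    simp [this, hD0]

theorem map_mem_Rng (hD0 : D (X 0) = 0) (hD : ∀ i : ℕ, D (X (i + 1)) = X i) {n g : ℕ}
    {p : MvPolynomial ℕ ℂ} (hp : p ∈ Rng n (g + 1)) : D p ∈ Rng n g := by
  induction n generalizing g p with
  | zero =>
    have : D p = 0 := Rng_zero_left_le_ker _ hp
    rw [this]
    exact zero_mem _
  | succ n ih =>
    refine Rng_succ_le (M := (Rng (n + 1) g).comap
      (D : MvPolynomial ℕ ℂ →ₗ[ℂ] MvPolynomial ℕ ℂ)) (fun w k q hwk hq => ?_) hp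
    change D (q * X k) ∈ Rng (n + 1) g
    rw [D.leibniz, smul_eq_mul, smul_eq_mul, mul_comm (X k)]
    refine add_mem ?_ ?_
    · cases k with
      | zero => rw [hD0, mul_zero]; exact zero_mem _
      | succ k =>
        obtain rfl : w + k = g := by omega
        rw [hD]
        exact mul_X_mem_Rng hq k
    · cases w with
      | zero =>
        have : D q = 0 := Rng_zero_right_le_ker hD0 n hq
        rw [this, zero_mul]
        exact zero_mem _
      | succ w =>
        obtain rfl : w + k = g := by omega
        exact mul_X_mem_Rng (ih hq) k

/-- Integration by parts: `p * a_k = D (p * a_{k+1}) - D p * a_{k+1}`. -/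
theorem mul_X_mem_map (hD0 : D (X 0) = 0) (hD : ∀ i : ℕ, D (X (i + 1)) = X i) {n w : ℕ} (k : ℕ)
    {p : MvPolynomial ℕ ℂ} (hp : p ∈ Rng n w) :
    p * X k ∈ (Rng (n + 1) (w + k + 1)).map
      (D : MvPolynomial ℕ ℂ →ₗ[ℂ] MvPolynomial ℕ ℂ) := by
  have parts (k : ℕ) (p : MvPolynomial ℕ ℂ) : p * X k = D (p * X (k + 1)) - D p * X (k + 1) := by
    rw [D.leibniz, hD, smul_eq_mul, smul_eq_mul]
    ring
  induction w generalizing k p with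
  | zero =>
    have hDp : D p = 0 := Rng_zero_right_le_ker hD0 n hp
    rw [parts, hDp, zero_mul, sub_zero]
    exact Submodule.mem_map_of_mem (mul_X_mem_Rng hp (k + 1))
  | succ w ih =>
    have hDp := map_mem_Rng hD0 hD hp
    rw [parts]
    refine sub_mem (Submodule.mem_map_of_mem (mul_X_mem_Rng hp (k + 1))) ?_
    rw [show w + 1 + k + 1 = w + (k + 1) + 1 by omega]
    exact ih (k + 1) hDp

theorem map_Rng (hD0 : D (X 0) = 0) (hD : ∀ i : ℕ, D (X (i + 1)) = X i) (n g : ℕ) :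
    (Rng (n + 1) (g + 1)).map (D : MvPolynomial ℕ ℂ →ₗ[ℂ] MvPolynomial ℕ ℂ) = Rng (n + 1) g := by
  refine le_antisymm ?_ (Rng_succ_le ?_)
  · rintro _ ⟨p, hp, rfl⟩
    exact map_mem_Rng hD0 hD hp
  · rintro w k p rfl hp
    exact mul_X_mem_map hD0 hD k hp

end Derivation

theorem finrank_map_add_finrank_ker_inf {K V W : Type*} [DivisionRing K] [AddCommGroup V]
    [Module K V] [AddCommGroup W] [Module K W] (f : V →ₗ[K] W) (M : Submodule K V)
    [FiniteDimensional K M] :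
    Module.finrank K (M.map f) + Module.finrank K ↥(LinearMap.ker f ⊓ M) =
      Module.finrank K M := by
  rw [← LinearMap.finrank_range_add_finrank_ker (f.domRestrict M), LinearMap.range_domRestrict,
    LinearMap.ker_domRestrict, inf_comm, ← Submodule.map_comap_subtype,
    Submodule.finrank_map_subtype_eq]

/-- `dim_ℂ S_{n,g}` equals the number of tuples `(k₂,…,kₙ) ∈ ℕ^{n-1}` with
`2k₂+3k₃+⋯+nkₙ = g`, i.e. the number of partitions of `g` with all parts between `2`
and `n`.  Here `S_{n,g} = (ker D) ∩ R_{n,g}` where `D` is the derivation with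
`D a₀ = 0`, `D aᵢ = a_{i-1}`. -/
theorem stmt8
    (D : Derivation ℂ (MvPolynomial ℕ ℂ) (MvPolynomial ℕ ℂ))
    (hD0 : D (X 0) = 0) (hD : ∀ i : ℕ, D (X (i + 1)) = X i)
    (n : ℕ) (hn : 1 ≤ n) (g : ℕ) :
    Module.finrank ℂ
        ↥(LinearMap.ker (D : MvPolynomial ℕ ℂ →ₗ[ℂ] MvPolynomial ℕ ℂ) ⊓ Rng n g) =
      ((Fintype.piFinset fun _ : Fin (n - 1) => Finset.range (g + 1)).filter
        (fun k => ∑ i : Fin (n - 1), ((i : ℕ) + 2) * k i = g)).card := by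
  obtain ⟨n, rfl⟩ := Nat.exists_eq_add_of_le' hn
  rw [← Set.ncard_coe_finset, coe_filter_piFinset, Nat.add_sub_cancel]
  cases g with
  | zero =>
    rw [inf_eq_right.mpr (Rng_zero_right_le_ker hD0 _), finrank_Rng, ncard_exponents_zero_right,
      ncard_multiplicities_zero_right]
  | succ g =>
    have h := finrank_map_add_finrank_ker_inf
      (D : MvPolynomial ℕ ℂ →ₗ[ℂ] MvPolynomial ℕ ℂ) (Rng (n + 1) (g + 1))
    rw [map_Rng hD0 hD, finrank_Rng, finrank_Rng, ncard_exponents_add_one] at h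
    exact Nat.add_left_cancel h
end
end

section
/- Let n > 2 and 1 ≤ h ≤ n/2. An Sₙ-invariant element f ∈ Σ̄_{n,g} lies in the ideal of Aₙ generated by λ̄₁+⋯+λ̄_h if and only if f is divisible by p_h in Aₙ. -/
open MvPolynomial

noncomputable section

/-- `λ̄ᵢ` (`i = 1,…,n`) in `Aₙ = ℂ[λ₁,…,λₙ]/(λ₁+⋯+λₙ)`, identified with the polynomial
ring `ℂ[λ̄₁,…,λ̄_{n-1}]` via `λ̄ₙ = −(λ̄₁+⋯+λ̄_{n-1})`. -/
def lamb (n : ℕ) (i : Fin n) : MvPolynomial (Fin (n - 1)) ℂ :=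
  if h : (i : ℕ) < n - 1 then X ⟨(i : ℕ), h⟩ else -(∑ j : Fin (n - 1), X j)

/-- `λ̄_T := ∑_{i∈T} λ̄ᵢ` for a subset `T ⊆ {1,…,n}`. -/
def lamT (n : ℕ) (T : Finset (Fin n)) : MvPolynomial (Fin (n - 1)) ℂ :=
  ∑ i ∈ T, lamb n i

/-- `p_h`: for `2h < n` the product of the `λ̄_T` over all `T` with `|T| = h`; for
`n = 2h` the product over those `T` with `|T| = h` containing the first index. -/
def pP (n h : ℕ) : MvPolynomial (Fin (n - 1)) ℂ :=
  if 2 * h < n then ∏ T ∈ Finset.powersetCard h (Finset.univ : Finset (Fin n)), lamT n T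
  else ∏ T ∈ (Finset.powersetCard h (Finset.univ : Finset (Fin n))).filter
      (fun T => ∃ i : Fin n, i ∈ T ∧ (i : ℕ) = 0), lamT n T

/-- The induced `Sₙ`-action on `Aₙ ≅ ℂ[λ̄₁,…,λ̄_{n-1}]`, permuting `λ̄₁,…,λ̄ₙ`. -/
def permAct (n : ℕ) (σ : Equiv.Perm (Fin n)) :
    MvPolynomial (Fin (n - 1)) ℂ →ₐ[ℂ] MvPolynomial (Fin (n - 1)) ℂ :=
  aeval (fun j : Fin (n - 1) => lamb n (σ (Fin.castLE (Nat.sub_le n 1) j)))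

theorem sum_lamb {n : ℕ} (hn : 0 < n) : ∑ i, lamb n i = 0 := by
  obtain ⟨m, rfl⟩ : ∃ m, n = m + 1 := ⟨n - 1, by omega⟩
  rw [Fin.sum_univ_castSucc]
  simp [lamb]

theorem permAct_lamb {n : ℕ} (σ : Equiv.Perm (Fin n)) (i : Fin n) :
    permAct n σ (lamb n i) = lamb n (σ i) := by
  obtain ⟨m, rfl⟩ : ∃ m, n = m + 1 := ⟨n - 1, by have := i.2; omega⟩
  have hsum : ∑ j, lamb (m + 1) (σ j) = 0 :=
    (Equiv.sum_comp σ _).trans (sum_lamb m.succ_pos)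
  rw [Fin.sum_univ_castSucc] at hsum
  have hX (j : Fin m) : permAct (m + 1) σ (X j) = lamb (m + 1) (σ j.castSucc) :=
    aeval_X _ j
  induction i using Fin.lastCases with
  | last =>
    rw [lamb, dif_neg (by simp), map_neg, map_sum]
    exact (neg_eq_of_add_eq_zero_right ((congrArg (· + _)
      (Finset.sum_congr rfl fun j _ => hX j)).trans hsum))
  | cast j =>
    rw [lamb, dif_pos (by simp)]
    exact hX j

theorem permAct_lamT {n : ℕ} (σ : Equiv.Perm (Fin n)) (T : Finset (Fin n)) :
    permAct n σ (lamT n T) = lamT n (T.map σ.toEmbedding) := by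
  simp [lamT, permAct_lamb]

theorem isHomogeneous_lamT {n : ℕ} (T : Finset (Fin n)) : (lamT n T).IsHomogeneous 1 := by
  refine IsHomogeneous.sum _ _ _ fun i _ => ?_
  unfold lamb
  split_ifs
  · exact isHomogeneous_X _ _
  · exact (IsHomogeneous.sum _ _ _ fun j _ => isHomogeneous_X _ j).neg

/-- The linear form `λ̄_T` evaluates to the sum over `T` at any point of the hyperplane
`∑ vᵢ = 0`. -/
theorem eval_lamT {n : ℕ} (v : Fin n → ℂ) (hv : ∑ i, v i = 0) (T : Finset (Fin n)) :
    eval (fun j : Fin (n - 1) => v (Fin.castLE (Nat.sub_le n 1) j)) (lamT n T) =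
      ∑ i ∈ T, v i := by
  rw [lamT, map_sum]
  refine Finset.sum_congr rfl fun i _ => ?_
  obtain ⟨m, rfl⟩ : ∃ m, n = m + 1 := ⟨n - 1, by have := i.2; omega⟩
  rw [Fin.sum_univ_castSucc] at hv
  induction i using Fin.lastCases with
  | last =>
    rw [lamb, dif_neg (by simp), map_neg, map_sum]
    refine neg_eq_of_add_eq_zero_right (Eq.trans ?_ hv)
    congr 1
    exact Finset.sum_congr rfl fun j _ => eval_X j
  | cast j =>
    rw [lamb, dif_pos (by simp)]
    exact eval_X j

/-- At the point `e_a - e_c`, the form `λ̄_T` takes the value `[a ∈ T] - [c ∈ T]`. -/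
theorem exists_eval_lamT {n : ℕ} (a c : Fin n) :
    ∃ x : Fin (n - 1) → ℂ, ∀ T : Finset (Fin n),
      eval x (lamT n T) = (if a ∈ T then 1 else 0) - (if c ∈ T then 1 else 0) := by
  have hv : ∑ i, ((if a = i then 1 else 0) - (if c = i then 1 else 0) : ℂ) = 0 := by simp
  refine ⟨_, fun T => (eval_lamT _ hv T).trans ?_⟩
  rw [Finset.sum_sub_distrib, Finset.sum_ite_eq, Finset.sum_ite_eq]

theorem irreducible_lamT {n : ℕ} {T : Finset (Fin n)} (hT : T.Nonempty) (hT' : T ≠ Finset.univ) :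
    Irreducible (lamT n T) := by
  obtain ⟨a, ha⟩ := hT
  obtain ⟨c, hc⟩ : ∃ c, c ∉ T := by
    by_contra! H
    exact hT' (Finset.eq_univ_of_forall H)
  obtain ⟨x, hx⟩ := exists_eval_lamT a c
  have h0 : lamT n T ≠ 0 := by
    intro h
    have := hx T
    simp [h, ha, hc] at this
  refine irreducible_of_totalDegree_eq_one ((isHomogeneous_lamT T).totalDegree h0) fun y hy => ?_
  refine isUnit_iff_ne_zero.2 fun hy0 => h0 ?_
  ext i
  simpa [hy0] using hy i

theorem isRelPrime_lamT {n : ℕ} {S T : Finset (Fin n)} (hS : S.Nonempty) (hTS : ¬ T ⊆ S)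
    (hU : S ∪ T ≠ Finset.univ) : IsRelPrime (lamT n S) (lamT n T) := by
  obtain ⟨a, haT, haS⟩ := Finset.not_subset.1 hTS
  obtain ⟨c, hc⟩ : ∃ c, c ∉ S ∪ T := by
    by_contra! H
    exact hU (Finset.eq_univ_of_forall H)
  rw [Finset.mem_union, not_or] at hc
  have hS' : S ≠ Finset.univ := fun h => haS (h ▸ Finset.mem_univ a)
  refine (irreducible_lamT hS hS').isRelPrime_iff_not_dvd.2 ?_
  rintro ⟨u, hu⟩
  obtain ⟨x, hx⟩ := exists_eval_lamT a c
  have h := congrArg (eval x) hu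
  rw [map_mul, hx, hx] at h
  simp [haT, haS, hc.1, hc.2] at h

theorem lamT_dvd_of_card_eq {n : ℕ} {f : MvPolynomial (Fin (n - 1)) ℂ}
    (hf : ∀ σ : Equiv.Perm (Fin n), permAct n σ f = f) {S T : Finset (Fin n)}
    (hST : S.card = T.card) (hS : lamT n S ∣ f) : lamT n T ∣ f := by
  obtain ⟨σ, hσ⟩ := Equiv.Perm.exists_map_finset_eq S T hST
  have h := map_dvd (permAct n σ) hS
  rwa [hf, permAct_lamT, hσ] at h

/-- `p_h` is the product of the `λ̄_T` over a family of `h`-subsets that contains `{1,…,h}`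
and in which no two members cover `{1,…,n}`. -/
theorem exists_pP_eq_prod {n h : ℕ} (h1 : 1 ≤ h) (h2 : h ≤ n / 2) :
    ∃ F : Finset (Finset (Fin n)), pP n h = ∏ T ∈ F, lamT n T ∧
      Finset.univ.filter (fun i : Fin n => (i : ℕ) < h) ∈ F ∧
      (∀ T ∈ F, T.card = h) ∧ ∀ S ∈ F, ∀ T ∈ F, S ∪ T ≠ Finset.univ := by
  have hcard : (Finset.univ.filter (fun i : Fin n => (i : ℕ) < h)).card = h := by
    rw [Fin.card_filter_val_lt]
    omega
  by_cases hlt : 2 * h < n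
  · refine ⟨_, if_pos hlt, by simpa [Finset.mem_powersetCard] using hcard,
      fun T hT => (Finset.mem_powersetCard.1 hT).2, fun S hS T hT hU => ?_⟩
    have := Finset.card_union_le S T
    rw [hU, Finset.card_univ, Fintype.card_fin, (Finset.mem_powersetCard.1 hS).2,
      (Finset.mem_powersetCard.1 hT).2] at this
    omega
  · refine ⟨_, if_neg hlt, ?_, fun T hT =>
      (Finset.mem_powersetCard.1 (Finset.mem_filter.1 hT).1).2, fun S hS T hT hU => ?_⟩
    · refine Finset.mem_filter.2 ⟨by simpa [Finset.mem_powersetCard] using hcard,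
        ⟨0, by omega⟩, ?_, rfl⟩
      simp
      omega
    · obtain ⟨hS, i, hiS, hi⟩ := Finset.mem_filter.1 hS
      obtain ⟨hT, j, hjT, hj⟩ := Finset.mem_filter.1 hT
      obtain rfl : i = j := Fin.ext (hi.trans hj.symm)
      have hpos : 0 < (S ∩ T).card := Finset.card_pos.2 ⟨i, Finset.mem_inter.2 ⟨hiS, hjT⟩⟩
      have := Finset.card_union_add_card_inter S T
      rw [hU, Finset.card_univ, Fintype.card_fin, (Finset.mem_powersetCard.1 hS).2,
        (Finset.mem_powersetCard.1 hT).2] at this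
      omega

/-- for `n > 2`, `1 ≤ h ≤ n/2`, an `Sₙ`-invariant element `f ∈ Σ̄_{n,g}`
(homogeneous of degree `g`) lies in the ideal of `Aₙ` generated by `λ̄₁+⋯+λ̄_h` iff
`f` is divisible by `p_h` in `Aₙ`. -/
theorem stmt9 (n : ℕ) (hn : 2 < n) (h : ℕ) (h1 : 1 ≤ h) (h2 : h ≤ n / 2) (g : ℕ)
    (f : MvPolynomial (Fin (n - 1)) ℂ)
    (hfhom : f ∈ homogeneousSubmodule (Fin (n - 1)) ℂ g)
    (hfsym : ∀ σ : Equiv.Perm (Fin n), permAct n σ f = f) :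
    f ∈ Ideal.span {lamT n (Finset.univ.filter (fun i : Fin n => (i : ℕ) < h))} ↔
      ∃ u : MvPolynomial (Fin (n - 1)) ℂ, f = pP n h * u := by
  obtain ⟨F, hF, hmem, hcard, hunion⟩ := exists_pP_eq_prod h1 h2
  rw [Ideal.mem_span_singleton, hF]
  change _ ↔ _ ∣ f
  refine ⟨fun hdvd => ?_, (Finset.dvd_prod_of_mem _ hmem).trans⟩
  refine Finset.prod_dvd_of_isRelPrime (fun S hS T hT hne => ?_) fun T hT =>
    lamT_dvd_of_card_eq hfsym ((hcard _ hmem).trans (hcard T hT).symm) hdvd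
  refine isRelPrime_lamT (Finset.card_pos.1 (by have := hcard S hS; omega)) (fun hsub => ?_)
    (hunion S hS T hT)
  exact hne (Finset.eq_of_subset_of_card_le hsub ((hcard S hS).trans (hcard T hT).symm).le).symm
end
end
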